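/- arXiv:2501.04887 — 2 statements merged into one kernel-verified Lean document; each statement's English description precedes it below -/
import Mathlib

section
/- There exists a constant C > 0 depending only on P and Q such that for every admissible prime p and all 1-bounded functions f0, f1, f2 : F_p^2 → ℂ, one has |𝔼_{x1,x2,y} f0(x1,x2) f1(x1+P(y),x2) f2(x1,x2+Q(y))| ≤ ‖f0‖_2 · ‖f1‖_4 · ‖f2‖_4^{1/2} · ‖f2‖_{U^2(0×F_p)}^{1/4} · ( |Y(F_p)| / p^6 )^{1/16}, where Y(F_p) is the set of F_p-points of the Roth variety for corners associated to P, Q. -/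
open scoped BigOperators ComplexOrder
open Polynomial

noncomputable section

namespace RatCorners

/-- Reduction of a rational number modulo `p` (genuine when `p` does not divide the
denominator). -/
def ratRed (p : ℕ) (q : ℚ) : ZMod p := (q.num : ZMod p) * (q.den : ZMod p)⁻¹

/-- Coefficientwise reduction of a polynomial with rational coefficients modulo `p`. -/
def polyRed (p : ℕ) (f : Polynomial ℚ) : Polynomial (ZMod p) :=
  f.sum fun n a => Polynomial.C (ratRed p a) * Polynomial.X ^ n

/-- `p` divides no denominator of any coefficient of `P` (with numerator and denominator
of `P` in lowest terms). -/
def Admissible (p : ℕ) (P : RatFunc ℚ) : Prop :=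
  (∀ n, ¬ p ∣ (P.num.coeff n).den) ∧ ∀ n, ¬ p ∣ (P.denom.coeff n).den

/-- `y` is a pole of the reduction of `P` modulo `p`. -/
def IsPole (p : ℕ) (P : RatFunc ℚ) (y : ZMod p) : Prop :=
  (polyRed p P.denom).eval y = 0

instance (p : ℕ) (P : RatFunc ℚ) : DecidablePred (IsPole p P) := fun y =>
  inferInstanceAs (Decidable ((polyRed p P.denom).eval y = 0))

/-- Evaluation of the reduction of `P` modulo `p` at `y` (junk value `0` at poles). -/
def evalRed (p : ℕ) (P : RatFunc ℚ) (y : ZMod p) : ZMod p :=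
  (polyRed p P.num).eval y * ((polyRed p P.denom).eval y)⁻¹

/-- A function is `1`-bounded if all its values have norm at most `1`. -/
def OneBounded {α : Type*} (f : α → ℂ) : Prop := ∀ x, ‖f x‖ ≤ 1

/-- The formal derivative of a rational function. -/
def ratDeriv (P : RatFunc ℚ) : RatFunc ℚ :=
  algebraMap (Polynomial ℚ) (RatFunc ℚ)
      (Polynomial.derivative P.num * P.denom - P.num * Polynomial.derivative P.denom) /
    algebraMap (Polynomial ℚ) (RatFunc ℚ) (P.denom ^ 2)

/-- Substitution of the variable `y i` into a rational function `P ∈ ℚ(t)`, producing an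
element of the rational function field `ℚ(y 0, …, y (n-1))`. -/
def substAt {n : ℕ} (P : RatFunc ℚ) (i : Fin n) : FractionRing (MvPolynomial (Fin n) ℚ) :=
  Polynomial.eval₂
      ((algebraMap (MvPolynomial (Fin n) ℚ) (FractionRing (MvPolynomial (Fin n) ℚ))).comp
        MvPolynomial.C)
      (algebraMap (MvPolynomial (Fin n) ℚ) (FractionRing (MvPolynomial (Fin n) ℚ))
        (MvPolynomial.X i)) P.num /
    Polynomial.eval₂
      ((algebraMap (MvPolynomial (Fin n) ℚ) (FractionRing (MvPolynomial (Fin n) ℚ))).comp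
        MvPolynomial.C)
      (algebraMap (MvPolynomial (Fin n) ℚ) (FractionRing (MvPolynomial (Fin n) ℚ))
        (MvPolynomial.X i)) P.denom

variable (p : ℕ) [NeZero p]

/-- The counting operator `𝔼_{x₁,x₂,y} f₀(x₁,x₂) f₁(x₁+P(y),x₂) f₂(x₁,x₂+Q(y))`,
where the average in `y` avoids the poles of `P` and `Q` but is still normalized by `1/p`. -/
def cornerAvg (P Q : RatFunc ℚ) (f0 f1 f2 : ZMod p × ZMod p → ℂ) : ℂ :=
  (p : ℂ)⁻¹ ^ 3 * ∑ x1 : ZMod p, ∑ x2 : ZMod p, ∑ y : ZMod p,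
    if ¬ IsPole p P y ∧ ¬ IsPole p Q y then
      f0 (x1, x2) * f1 (x1 + evalRed p P y, x2) * f2 (x1, x2 + evalRed p Q y)
    else 0

/-- The main term `𝔼_{x₁,x₂} f₀(x₁,x₂) · 𝔼_a f₁(a,x₂) · 𝔼_b f₂(x₁,b)`. -/
def mainTerm (f0 f1 f2 : ZMod p × ZMod p → ℂ) : ℂ :=
  (p : ℂ)⁻¹ ^ 2 * ∑ x1 : ZMod p, ∑ x2 : ZMod p,
    f0 (x1, x2) * ((p : ℂ)⁻¹ * ∑ a : ZMod p, f1 (a, x2)) *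
      ((p : ℂ)⁻¹ * ∑ b : ZMod p, f2 (x1, b))

/-- The `L^r` norm with respect to the uniform probability measure on `(ZMod p)²`. -/
def Lnorm (r : ℝ) (f : ZMod p × ZMod p → ℂ) : ℝ :=
  ((p : ℝ)⁻¹ ^ 2 * ∑ x : ZMod p × ZMod p, ‖f x‖ ^ r) ^ r⁻¹

/-- The Gowers norm `‖f‖_{U²(0×F_p)}` along the second coordinate axis. -/
def U2vert (f : ZMod p × ZMod p → ℂ) : ℝ :=
  ((p : ℝ)⁻¹ ^ 4 * (∑ x : ZMod p × ZMod p, ∑ h : ZMod p, ∑ k : ZMod p,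
      f x * (starRingEnd ℂ) (f (x + (0, h))) * (starRingEnd ℂ) (f (x + (0, k))) *
        f (x + (0, h + k))).re) ^ ((4:ℝ)⁻¹)

/-- The Gowers norm `‖f‖_{U²(F_p×0)}` along the first coordinate axis. -/
def U2horiz (f : ZMod p × ZMod p → ℂ) : ℝ :=
  ((p : ℝ)⁻¹ ^ 4 * (∑ x : ZMod p × ZMod p, ∑ h : ZMod p, ∑ k : ZMod p,
      f x * (starRingEnd ℂ) (f (x + (h, 0))) * (starRingEnd ℂ) (f (x + (k, 0))) *
        f (x + (h + k, 0))).re) ^ ((4:ℝ)⁻¹)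

/-- The additive character `e_p(x) = e^{2πix/p}` on `ZMod p`. -/
def ep (x : ZMod p) : ℂ := Complex.exp (2 * Real.pi * Complex.I * (x.val : ℂ) / (p : ℂ))

/-- `e(r) = e^{2πir}` for a real number `r`. -/
def eC (r : ℝ) : ℂ := Complex.exp (2 * Real.pi * Complex.I * (r : ℂ))

/-- The Fourier transform `f̂(ξ) = 𝔼_x f(x) e_p(−x·ξ)` on `(ZMod p)²`. -/
def dft (f : ZMod p × ZMod p → ℂ) (ξ : ZMod p × ZMod p) : ℂ :=
  (p : ℂ)⁻¹ ^ 2 * ∑ x : ZMod p × ZMod p, f x * ep p (-(x.1 * ξ.1 + x.2 * ξ.2))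

/-- `F₁(n₁,𝐡) = ∑_{n₂} Δ_{−𝐡} f̂₁(n₁,n₂)` where `Δ_h g(x) = g(x)·conj g(x+h)`. -/
def F1 (f : ZMod p × ZMod p → ℂ) (n1 : ZMod p) (h : ZMod p × ZMod p) : ℂ :=
  ∑ n2 : ZMod p, dft p f (n1, n2) * (starRingEnd ℂ) (dft p f ((n1, n2) + -h))

/-- `F₂(m₂,𝐡) = ∑_{m₁} Δ_{𝐡} f̂₂(m₁,m₂)` where `Δ_h g(x) = g(x)·conj g(x+h)`. -/
def F2 (f : ZMod p × ZMod p → ℂ) (m2 : ZMod p) (h : ZMod p × ZMod p) : ℂ :=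
  ∑ m1 : ZMod p, dft p f (m1, m2) * (starRingEnd ℂ) (dft p f ((m1, m2) + h))

/-- The `F_p`-points of the Roth variety for corners associated to `P, Q`:
tuples `(y₁,…,y₁₆)` (indexed here by `0,…,15`) avoiding all poles of `P` and `Q` and
satisfying the ten defining equations. -/
def IsRothPoint (P Q : RatFunc ℚ) (y : Fin 16 → ZMod p) : Prop :=
  (∀ i, ¬ IsPole p P (y i)) ∧ (∀ i, ¬ IsPole p Q (y i)) ∧
  evalRed p P (y 0) - evalRed p P (y 2) - evalRed p P (y 8) + evalRed p P (y 10) = 0 ∧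
  evalRed p P (y 1) - evalRed p P (y 3) - evalRed p P (y 9) + evalRed p P (y 11) = 0 ∧
  evalRed p P (y 4) - evalRed p P (y 6) - evalRed p P (y 12) + evalRed p P (y 14) = 0 ∧
  evalRed p P (y 5) - evalRed p P (y 7) - evalRed p P (y 13) + evalRed p P (y 15) = 0 ∧
  evalRed p Q (y 0) - evalRed p Q (y 1) - evalRed p Q (y 8) + evalRed p Q (y 9) = 0 ∧
  evalRed p Q (y 2) - evalRed p Q (y 6) - evalRed p Q (y 10) + evalRed p Q (y 14) = 0 ∧
  evalRed p Q (y 3) - evalRed p Q (y 7) - evalRed p Q (y 11) + evalRed p Q (y 15) = 0 ∧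
  evalRed p Q (y 4) - evalRed p Q (y 5) - evalRed p Q (y 12) + evalRed p Q (y 13) = 0 ∧
  evalRed p P (y 8) - evalRed p P (y 9) - evalRed p P (y 10) + evalRed p P (y 11) -
      evalRed p P (y 12) + evalRed p P (y 13) + evalRed p P (y 14) - evalRed p P (y 15) = 0 ∧
  evalRed p Q (y 8) - evalRed p Q (y 9) - evalRed p Q (y 10) + evalRed p Q (y 11) -
      evalRed p Q (y 12) + evalRed p Q (y 13) + evalRed p Q (y 14) - evalRed p Q (y 15) = 0

/-- `|Y(F_p)|`, the number of `F_p`-points of the Roth variety for corners. -/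
def rothCard (P Q : RatFunc ℚ) : ℕ :=
  Nat.card {y : Fin 16 → ZMod p // IsRothPoint p P Q y}

/-- `χ` is an eigenfunction with respect to the first coordinate:
`χ(x₁,x₂) = 1_E(x₂) e_p(φ(x₂)x₁) e(ψ(x₂))`. -/
def IsEigen1 (χ : ZMod p × ZMod p → ℂ) : Prop :=
  ∃ (E : Finset (ZMod p)) (φ : ZMod p → ZMod p) (ψ : ZMod p → ℝ),
    ∀ x1 x2 : ZMod p,
      χ (x1, x2) = (if x2 ∈ E then 1 else 0) * ep p (φ x2 * x1) * eC (ψ x2)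

/-- `χ` is an eigenfunction with respect to the second coordinate:
`χ(x₁,x₂) = 1_E(x₁) e_p(φ(x₁)x₂) e(ψ(x₁))`. -/
def IsEigen2 (χ : ZMod p × ZMod p → ℂ) : Prop :=
  ∃ (E : Finset (ZMod p)) (φ : ZMod p → ZMod p) (ψ : ZMod p → ℝ),
    ∀ x1 x2 : ZMod p,
      χ (x1, x2) = (if x1 ∈ E then 1 else 0) * ep p (φ x1 * x2) * eC (ψ x1)

/-- The two-term counting operator `𝔼_{x₁,x₂,y} f₀(x₁,x₂) f₁(x₁+P(y),x₂)`. -/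
def twoAvg1 (P : RatFunc ℚ) (f0 f1 : ZMod p × ZMod p → ℂ) : ℂ :=
  (p : ℂ)⁻¹ ^ 3 * ∑ x1 : ZMod p, ∑ x2 : ZMod p, ∑ y : ZMod p,
    if ¬ IsPole p P y then f0 (x1, x2) * f1 (x1 + evalRed p P y, x2) else 0

/-- The two-term counting operator `𝔼_{x₁,x₂,y} f₀(x₁,x₂) f₁(x₁,x₂+P(y))`. -/
def twoAvg2 (P : RatFunc ℚ) (f0 f1 : ZMod p × ZMod p → ℂ) : ℂ :=
  (p : ℂ)⁻¹ ^ 3 * ∑ x1 : ZMod p, ∑ x2 : ZMod p, ∑ y : ZMod p,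
    if ¬ IsPole p P y then f0 (x1, x2) * f1 (x1, x2 + evalRed p P y) else 0

theorem norm_sum_mul_sq_le {ι : Type*} [Fintype ι] (f g : ι → ℂ) :
    ‖∑ i, f i * g i‖ ^ 2 ≤ (∑ i, ‖f i‖ ^ 2) * ∑ i, ‖g i‖ ^ 2 := by
  calc ‖∑ i, f i * g i‖ ^ 2 ≤ (∑ i, ‖f i‖ * ‖g i‖) ^ 2 := by
        gcongr
        exact (norm_sum_le _ _).trans_eq (by simp)
    _ ≤ _ := Finset.sum_mul_sq_le_sq_mul_sq _ _ _

theorem norm_sum_sq_le_card_mul {ι : Type*} [Fintype ι] (f : ι → ℂ) :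
    ‖∑ i, f i‖ ^ 2 ≤ Fintype.card ι * ∑ i, ‖f i‖ ^ 2 := by
  simpa using norm_sum_mul_sq_le (fun _ => 1) f

theorem norm_sum_comp_sq_le {Ω K : Type*} [Fintype Ω] [Fintype K]
    (φ : Ω → K) (R : K → ℂ) :
    ‖∑ ω, R (φ ω)‖ ^ 2 ≤
      (Nat.card {w : Ω × Ω // φ w.1 = φ w.2} : ℝ) * ∑ k, ‖R k‖ ^ 2 := by
  classical
  have h1 : ∑ ω, R (φ ω) = ∑ k, (∑ ω, if φ ω = k then (1 : ℂ) else 0) * R k := by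
    simp_rw [Finset.sum_mul]
    rw [Finset.sum_comm]
    simp
  have h2 : (Nat.card {w : Ω × Ω // φ w.1 = φ w.2} : ℝ) =
      ∑ k, ‖∑ ω, if φ ω = k then (1 : ℂ) else 0‖ ^ 2 := by
    have h3 : ∀ k, ‖∑ ω, if φ ω = k then (1 : ℂ) else 0‖ ^ 2 =
        ∑ ω, ∑ ω', if φ ω = k then if φ ω' = k then (1 : ℝ) else 0 else 0 := by
      intro k
      have : (∑ ω, if φ ω = k then (1 : ℂ) else 0) =
          ((∑ ω, if φ ω = k then (1 : ℝ) else 0 : ℝ) : ℂ) := by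
        push_cast
        exact Finset.sum_congr rfl fun ω _ => by split_ifs <;> simp
      rw [this, Complex.norm_real, Real.norm_eq_abs, sq_abs, sq, Finset.sum_mul_sum]
      refine Finset.sum_congr rfl fun ω _ => Finset.sum_congr rfl fun ω' _ => ?_
      split_ifs <;> simp
    simp_rw [h3]
    rw [Finset.sum_comm]
    conv_rhs => enter [2, ω]; rw [Finset.sum_comm]
    rw [Nat.card_eq_fintype_card, Fintype.card_subtype, Finset.card_filter,
      Fintype.sum_prod_type]
    push_cast
    simp [eq_comm]
  rw [h1, h2]
  exact norm_sum_mul_sq_le _ _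

section GroupSums

variable {G : Type*} [AddCommGroup G] [Fintype G]

/-- The autocorrelation `δ ↦ ∑ₜ g(t) conj g(t + δ)`. -/
def autocorr (g : G → ℂ) (δ : G) : ℂ := ∑ t, g t * (starRingEnd ℂ) (g (t + δ))

theorem ofReal_norm_sum_sq (h : G → ℂ) :
    ((‖∑ t, h t‖ ^ 2 : ℝ) : ℂ) = ∑ δ, ∑ t, h t * (starRingEnd ℂ) (h (t + δ)) := by
  rw [Complex.ofReal_pow, ← Complex.mul_conj', map_sum, Finset.sum_mul_sum, Finset.sum_comm]
  rw [Finset.sum_comm]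
  conv_rhs => rw [Finset.sum_comm]
  refine Finset.sum_congr rfl fun t _ => ?_
  exact (Fintype.sum_equiv (Equiv.addLeft t) _ (fun s => h t * (starRingEnd ℂ) (h s)) fun _ => rfl).symm

theorem sum_norm_sq_autocorr (g : G → ℂ) :
    ((∑ δ, ‖autocorr g δ‖ ^ 2 : ℝ) : ℂ) =
      ∑ t, ∑ h, ∑ k, g t * (starRingEnd ℂ) (g (t + h)) * (starRingEnd ℂ) (g (t + k)) *
        g (t + (h + k)) := by
  rw [Complex.ofReal_sum, Finset.sum_comm]
  refine Finset.sum_congr rfl fun h _ => ?_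
  unfold autocorr
  rw [ofReal_norm_sum_sq, Finset.sum_comm]
  refine Finset.sum_congr rfl fun t _ => Finset.sum_congr rfl fun k _ => ?_
  simp only [map_mul, Complex.conj_conj]
  rw [show t + k + h = t + (h + k) by abel]
  ring

theorem sum_comm_three {α M : Type*} [Fintype α] [AddCommMonoid M] (F : α → α → α → α → M) :
    ∑ a, ∑ b, ∑ c, ∑ d, F a b c d = ∑ d, ∑ a, ∑ b, ∑ c, F a b c d := by
  have h1 : ∀ a b, ∑ c, ∑ d, F a b c d = ∑ d, ∑ c, F a b c d := fun a b => Finset.sum_comm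
  have h2 : ∀ a, ∑ b, ∑ d, ∑ c, F a b c d = ∑ d, ∑ b, ∑ c, F a b c d :=
    fun a => Finset.sum_comm
  simp_rw [h1, h2]
  exact Finset.sum_comm

theorem sum_norm_sq_correlation (g k : G → ℂ) :
    ∑ d, ∑ v, ∑ w, ‖∑ t, g (t + v) * (starRingEnd ℂ) (g t) *
        ((starRingEnd ℂ) (k (t + d + w)) * k (t + d))‖ ^ 2 =
      ∑ δ, ‖autocorr g δ‖ ^ 2 * ‖autocorr k δ‖ ^ 2 := by
  apply Complex.ofReal_injective
  rw [Complex.ofReal_sum, Complex.ofReal_sum]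
  simp_rw [Complex.ofReal_sum, ofReal_norm_sum_sq, Complex.ofReal_mul, Complex.ofReal_pow,
    ← Complex.mul_conj']
  rw [sum_comm_three]
  refine Finset.sum_congr rfl fun δ _ => ?_
  rw [sum_comm_three]
  have e2 : ∀ t d, ∑ w, (starRingEnd ℂ) (k (t + d + w)) * k (t + d + w + δ) =
      (starRingEnd ℂ) (autocorr k δ) := by
    intro t d
    rw [autocorr, map_sum]
    exact Fintype.sum_equiv (Equiv.addLeft (t + d)) _ _ fun w => by simp [add_assoc]
  have e3 : ∀ t, ∑ v, g (t + v) * (starRingEnd ℂ) (g (t + v + δ)) = autocorr g δ := by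
    intro t
    exact Fintype.sum_equiv (Equiv.addLeft t) _ _ fun w => by simp [add_assoc]
  have e4 : ∀ t, ∑ d, k (t + d) * (starRingEnd ℂ) (k (t + d + δ)) = autocorr k δ := by
    intro t
    exact Fintype.sum_equiv (Equiv.addLeft t) _ _ fun w => by simp [add_assoc]
  have e5 : ∑ t, (starRingEnd ℂ) (g t) * g (t + δ) = (starRingEnd ℂ) (autocorr g δ) := by
    rw [autocorr, map_sum]
    exact Finset.sum_congr rfl fun w _ => by simp
  calc _ = ∑ t, (starRingEnd ℂ) (g t) * g (t + δ) *
        ∑ d, k (t + d) * (starRingEnd ℂ) (k (t + d + δ)) *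
          ∑ v, g (t + v) * (starRingEnd ℂ) (g (t + v + δ)) *
            ∑ w, (starRingEnd ℂ) (k (t + d + w)) * k (t + d + w + δ) := by
        simp_rw [Finset.mul_sum]
        refine Finset.sum_congr rfl fun t _ => Finset.sum_congr rfl fun d _ =>
          Finset.sum_congr rfl fun v _ => Finset.sum_congr rfl fun w _ => ?_
        simp only [map_mul, Complex.conj_conj]
        rw [show t + δ + v = t + v + δ by abel, show t + δ + d + w = t + d + w + δ by abel,
          show t + δ + d = t + d + δ by abel]
        ring
    _ = _ := by
        simp only [e2, e3, e4, e5, ← Finset.sum_mul]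
        ring

theorem norm_autocorr_le {g : G → ℂ} (hg : ∀ x, ‖g x‖ ≤ 1) (δ : G) :
    ‖autocorr g δ‖ ≤ Fintype.card G := by
  refine (norm_sum_le _ _).trans ?_
  calc _ ≤ ∑ _t : G, (1 : ℝ) := Finset.sum_le_sum fun t _ => by
        rw [norm_mul, RCLike.norm_conj]
        exact mul_le_one₀ (hg _) (norm_nonneg _) (hg _)
    _ = _ := by simp

/-- The multiplicative derivative of `f` along the second coordinate axis. -/
def vertDiff (f : G × G → ℂ) (x t v : G) : ℂ := f (x, t + v) * (starRingEnd ℂ) (f (x, t))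

theorem sum_norm_sq_vertDiff_correlation_le {f : G × G → ℂ} (hf : ∀ x, ‖f x‖ ≤ 1) :
    ∑ κ : G × G × G × G, ‖∑ x, ∑ t, vertDiff f x t κ.2.2.1 *
        (starRingEnd ℂ) (vertDiff f (x + κ.1) (t + κ.2.1) κ.2.2.2)‖ ^ 2 ≤
      (Fintype.card G : ℝ) ^ 4 * ∑ x, ∑ δ, ‖autocorr (fun t => f (x, t)) δ‖ ^ 2 := by
  set N : ℝ := (Fintype.card G : ℝ) with hN
  simp only [Fintype.sum_prod_type]
  calc _ ≤ ∑ c, ∑ d, ∑ v, ∑ w, N * ∑ x, ‖∑ t, vertDiff f x t v *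
        (starRingEnd ℂ) (vertDiff f (x + c) (t + d) w)‖ ^ 2 := by
        refine Finset.sum_le_sum fun c _ => Finset.sum_le_sum fun d _ =>
          Finset.sum_le_sum fun v _ => Finset.sum_le_sum fun w _ => ?_
        exact norm_sum_sq_le_card_mul _
    _ = N * ∑ c, ∑ x, ∑ d, ∑ v, ∑ w, ‖∑ t, vertDiff f x t v *
        (starRingEnd ℂ) (vertDiff f (x + c) (t + d) w)‖ ^ 2 := by
        simp_rw [← Finset.mul_sum]
        refine congrArg (N * ·) (Finset.sum_congr rfl fun c _ => ?_)
        exact sum_comm_three _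
    _ ≤ N * ∑ _c : G, ∑ x, N ^ 2 * ∑ δ, ‖autocorr (fun t => f (x, t)) δ‖ ^ 2 := by
        refine mul_le_mul_of_nonneg_left (Finset.sum_le_sum fun c _ =>
          Finset.sum_le_sum fun x _ => ?_) (Nat.cast_nonneg _)
        have := sum_norm_sq_correlation (fun t => f (x, t)) (fun t => f (x + c, t))
        have h2 : ∀ d v w t, vertDiff f x t v *
            (starRingEnd ℂ) (vertDiff f (x + c) (t + d) w) =
            f (x, t + v) * (starRingEnd ℂ) (f (x, t)) *
              ((starRingEnd ℂ) (f (x + c, t + d + w)) * f (x + c, t + d)) := by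
          intro d v w t
          simp [vertDiff]
        simp_rw [h2]
        rw [this, Finset.mul_sum]
        refine Finset.sum_le_sum fun δ _ => ?_
        rw [mul_comm]
        exact mul_le_mul_of_nonneg_right (pow_le_pow_left₀ (norm_nonneg _)
          (norm_autocorr_le (g := fun t => f (x + c, t)) (fun _ => hf _) δ) 2) (sq_nonneg _)
    _ = _ := by
        simp only [← Finset.mul_sum, Finset.sum_const, Finset.card_univ, nsmul_eq_mul]
        ring

section CorrOp

variable {Z : Type*} [Fintype Z] [DecidableEq G]

/-- The operator `F ↦ ∑_z 1_{u(z) = w} F(x + a(z), t + b(z), v(z))` on functions on `G³`. -/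
def corrOp (a b u v : Z → G) (F : G × G × G → ℂ) (κ : G × G × G) : ℂ :=
  ∑ z, if u z = κ.2.2 then F (κ.1 + a z, κ.2.1 + b z, v z) else 0

theorem sum_subtype_eq_sum_ite {ι M : Type*} [Fintype ι] [AddCommMonoid M] (q : ι → Prop)
    [DecidablePred q] (f : ι → M) :
    ∑ z : {z // q z}, f z = ∑ z, if q z then f z else 0 := by
  rw [← Finset.sum_filter]
  exact (Finset.sum_subtype _ (by simp) f).symm

theorem sum_comm_two {α β γ M : Type*} [Fintype α] [Fintype β] [Fintype γ] [AddCommMonoid M]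
    (F : α → β → γ → M) :
    ∑ c, ∑ a, ∑ b, F a b c = ∑ a, ∑ b, ∑ c, F a b c := by
  rw [Finset.sum_comm]
  exact Finset.sum_congr rfl fun _ _ => Finset.sum_comm

theorem sum_mul_corrOp (a b u v : Z → G) (H F : G × G × G → ℂ) :
    ∑ κ, H κ * corrOp a b u v F κ =
      ∑ z, ∑ x, ∑ t, H (x, t, u z) * F (x + a z, t + b z, v z) := by
  simp only [corrOp, Finset.mul_sum]
  rw [Finset.sum_comm]
  refine Finset.sum_congr rfl fun z _ => ?_
  simp only [Fintype.sum_prod_type, mul_ite, mul_zero]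
  simp

theorem sum_conj_mul_corrOp (a b u v : Z → G) (H F : G × G × G → ℂ) :
    ∑ κ, (starRingEnd ℂ) (H κ) * corrOp a b u v F κ =
      ∑ κ, F κ * (starRingEnd ℂ) (corrOp (-a) (-b) v u H κ) := by
  have h : ∀ κ, (starRingEnd ℂ) (corrOp (-a) (-b) v u H κ) =
      corrOp (-a) (-b) v u (fun κ => (starRingEnd ℂ) (H κ)) κ := by
    intro κ
    simp only [corrOp, map_sum]
    exact Finset.sum_congr rfl fun z _ => by split_ifs <;> simp
  simp_rw [h]
  rw [sum_mul_corrOp, sum_mul_corrOp]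
  refine Finset.sum_congr rfl fun z _ => ?_
  refine Fintype.sum_equiv (Equiv.addRight (a z)) _ _ fun x => ?_
  refine Fintype.sum_equiv (Equiv.addRight (b z)) _ _ fun t => ?_
  simp [mul_comm]

theorem corrOp_corrOp {G Z Z' : Type*} [AddCommGroup G] [DecidableEq G] [Fintype Z]
    [Fintype Z'] (a b u v : Z → G) (a' b' u' v' : Z' → G)
    (F : G × G × G → ℂ) :
    corrOp a b u v (corrOp a' b' u' v' F) =
      corrOp (Z := {z : Z × Z' // u' z.2 = v z.1}) (fun z => a z.1.1 + a' z.1.2)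
        (fun z => b z.1.1 + b' z.1.2) (fun z => u z.1.1) (fun z => v' z.1.2) F := by
  funext κ
  simp only [corrOp]
  rw [sum_subtype_eq_sum_ite (fun z : Z × Z' => u' z.2 = v z.1)
    (fun z => if u z.1 = κ.2.2 then F (κ.1 + (a z.1 + a' z.2), κ.2.1 + (b z.1 + b' z.2), v' z.2)
      else 0), Fintype.sum_prod_type]
  refine Finset.sum_congr rfl fun z _ => ?_
  split_ifs with h
  · simp [add_assoc]
  · simp

theorem sum_norm_sq_corrOp (a b u v : Z → G) (F : G × G × G → ℂ) :
    ((∑ κ, ‖corrOp a b u v F κ‖ ^ 2 : ℝ) : ℂ) =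
      ∑ z : {z : Z × Z // u z.1 = u z.2}, ∑ x, ∑ t, F (x, t, v z.1.1) *
        (starRingEnd ℂ) (F (x + (a z.1.2 - a z.1.1), t + (b z.1.2 - b z.1.1), v z.1.2)) := by
  push_cast
  simp_rw [← Complex.conj_mul']
  rw [sum_mul_corrOp, sum_subtype_eq_sum_ite (fun z : Z × Z => u z.1 = u z.2) (fun z =>
    ∑ x, ∑ t, F (x, t, v z.1) *
      (starRingEnd ℂ) (F (x + (a z.2 - a z.1), t + (b z.2 - b z.1), v z.2))),
    Fintype.sum_prod_type]
  refine Finset.sum_congr rfl fun z _ => ?_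
  simp only [corrOp, map_sum, Finset.sum_mul]
  rw [← sum_comm_two]
  refine Finset.sum_congr rfl fun z' _ => ?_
  split_ifs with h h' h'
  · refine Fintype.sum_equiv (Equiv.addRight (a z)) _ _ fun x => ?_
    refine Fintype.sum_equiv (Equiv.addRight (b z)) _ _ fun t => ?_
    simp [mul_comm]
  · exact absurd h.symm h'
  · exact absurd h'.symm h
  · simp

end CorrOp

theorem sum_norm_sq_diff_le (g : G → ℂ) :
    ∑ t, ∑ w, ‖g (t + w) * (starRingEnd ℂ) (g t)‖ ^ 2 ≤
      (Fintype.card G : ℝ) * ∑ t, ‖g t‖ ^ 4 := by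
  have h1 : ∀ t, ∑ w, ‖g (t + w) * (starRingEnd ℂ) (g t)‖ ^ 2 =
      ‖g t‖ ^ 2 * ∑ w, ‖g w‖ ^ 2 := by
    intro t
    rw [Finset.mul_sum]
    refine Fintype.sum_equiv (Equiv.addLeft t) _ _ fun w => ?_
    simp [mul_pow, mul_comm]
  simp_rw [h1, ← Finset.sum_mul, ← sq]
  have := sq_sum_le_card_mul_sum_sq (s := Finset.univ) (f := fun t => ‖g t‖ ^ 2)
  simpa [← pow_mul] using this

section RothTuples

variable {S : Type*} [Fintype S]

/-- The ten equations of the Roth variety for corners, for arbitrary functions `P, Q : S → G`. -/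
def IsRothTuple (P Q : S → G) (y : Fin 16 → S) : Prop :=
  P (y 0) - P (y 2) - P (y 8) + P (y 10) = 0 ∧
  P (y 1) - P (y 3) - P (y 9) + P (y 11) = 0 ∧
  P (y 4) - P (y 6) - P (y 12) + P (y 14) = 0 ∧
  P (y 5) - P (y 7) - P (y 13) + P (y 15) = 0 ∧
  Q (y 0) - Q (y 1) - Q (y 8) + Q (y 9) = 0 ∧
  Q (y 2) - Q (y 6) - Q (y 10) + Q (y 14) = 0 ∧
  Q (y 3) - Q (y 7) - Q (y 11) + Q (y 15) = 0 ∧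
  Q (y 4) - Q (y 5) - Q (y 12) + Q (y 13) = 0 ∧
  P (y 8) - P (y 9) - P (y 10) + P (y 11) -
      P (y 12) + P (y 13) + P (y 14) - P (y 15) = 0 ∧
  Q (y 8) - Q (y 9) - Q (y 10) + Q (y 11) -
      Q (y 12) + Q (y 13) + Q (y 14) - Q (y 15) = 0

/-- The difference `P(y) - P(y')` attached to a pair `(y, y')`. -/
def pairDiff (P : S → G) (z : S × S) : G := P z.1 - P z.2

/-- Two pairs with the same difference under `P`. -/
abbrev Link (P : S → G) : Type _ :=
  {z : (S × S) × (S × S) // pairDiff P z.2 = pairDiff P z.1}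

/-- Two `P`-links joined by a common difference under `Q`. -/
abbrev Chain (P Q : S → G) : Type _ :=
  {ζ : Link P × Link P // pairDiff Q ζ.1.1.1 = pairDiff Q ζ.2.1.1}

/-- The shift parameters attached to a chain. -/
def chainShift (P Q : S → G) (ω : Chain P Q) : G × G × G × G :=
  ((P ω.1.2.1.1.2 + -P ω.1.2.1.2.2) - (P ω.1.1.1.1.2 + -P ω.1.1.1.2.2),
    (-Q ω.1.2.1.1.2 + Q ω.1.2.1.2.2) - (-Q ω.1.1.1.1.2 + Q ω.1.1.1.2.2),
    pairDiff Q ω.1.1.1.2, pairDiff Q ω.1.2.1.2)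

theorem card_chain_pairs_le {G : Type*} [AddCommGroup G] (P Q : S → G) :
    Nat.card {w : Chain P Q × Chain P Q // chainShift P Q w.1 = chainShift P Q w.2} ≤
      Nat.card {y : Fin 16 → S // IsRothTuple P Q y} := by
  refine Nat.card_le_card_of_injective (fun w => ⟨
    ![w.1.1.1.1.1.1.1, w.1.1.1.2.1.1.1, w.1.1.1.1.1.2.1, w.1.1.1.2.1.2.1,
      w.1.2.1.1.1.1.1, w.1.2.1.2.1.1.1, w.1.2.1.1.1.2.1, w.1.2.1.2.1.2.1,
      w.1.1.1.1.1.1.2, w.1.1.1.2.1.1.2, w.1.1.1.1.1.2.2, w.1.1.1.2.1.2.2,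
      w.1.2.1.1.1.1.2, w.1.2.1.2.1.1.2, w.1.2.1.1.1.2.2, w.1.2.1.2.1.2.2], ?_⟩) ?_
  · obtain ⟨⟨⟨⟨⟨⟨⟨a1, b1⟩, ⟨a3, b3⟩⟩, h13⟩, ⟨⟨⟨a2, b2⟩, ⟨a4, b4⟩⟩, h24⟩⟩, h12⟩,
      ⟨⟨⟨⟨⟨a5, b5⟩, ⟨a7, b7⟩⟩, h57⟩, ⟨⟨⟨a6, b6⟩, ⟨a8, b8⟩⟩, h68⟩⟩, h56⟩⟩, h⟩ := w
    simp only [chainShift, Prod.mk.injEq, pairDiff] at h h13 h24 h12 h57 h68 h56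
    obtain ⟨h1, h2, h37, h48⟩ := h
    refine ⟨?_, ?_, ?_, ?_, ?_, ?_, ?_, ?_, ?_, ?_⟩
    · change P a1 - P a3 - P b1 + P b3 = 0
      grind
    · change P a2 - P a4 - P b2 + P b4 = 0
      grind
    · change P a5 - P a7 - P b5 + P b7 = 0
      grind
    · change P a6 - P a8 - P b6 + P b8 = 0
      grind
    · change Q a1 - Q a2 - Q b1 + Q b2 = 0
      grind
    · change Q a3 - Q a7 - Q b3 + Q b7 = 0
      grind
    · change Q a4 - Q a8 - Q b4 + Q b8 = 0
      grind
    · change Q a5 - Q a6 - Q b5 + Q b6 = 0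
      grind
    · change P b1 - P b2 - P b3 + P b4 - P b5 + P b6 + P b7 - P b8 = 0
      grind
    · change Q b1 - Q b2 - Q b3 + Q b4 - Q b5 + Q b6 + Q b7 - Q b8 = 0
      grind
  · rintro ⟨⟨⟨⟨⟨⟨⟨a1, b1⟩, ⟨a3, b3⟩⟩, h13⟩, ⟨⟨⟨a2, b2⟩, ⟨a4, b4⟩⟩, h24⟩⟩, h12⟩,
      ⟨⟨⟨⟨⟨a5, b5⟩, ⟨a7, b7⟩⟩, h57⟩, ⟨⟨⟨a6, b6⟩, ⟨a8, b8⟩⟩, h68⟩⟩, h56⟩⟩, h⟩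
      ⟨⟨⟨⟨⟨⟨⟨a1', b1'⟩, ⟨a3', b3'⟩⟩, h13'⟩, ⟨⟨⟨a2', b2'⟩, ⟨a4', b4'⟩⟩, h24'⟩⟩, h12'⟩,
      ⟨⟨⟨⟨⟨a5', b5'⟩, ⟨a7', b7'⟩⟩, h57'⟩, ⟨⟨⟨a6', b6'⟩, ⟨a8', b8'⟩⟩, h68'⟩⟩, h56'⟩⟩, h'⟩ e
    simp only [Subtype.mk.injEq, Matrix.vecCons_inj] at e
    simp only [Subtype.mk.injEq, Prod.mk.injEq]
    tauto


theorem sum_norm_sq_vertDiff_le (f : G × G → ℂ) :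
    ∑ κ : G × G × G, ‖vertDiff f κ.1 κ.2.1 κ.2.2‖ ^ 2 ≤
      (Fintype.card G : ℝ) * ∑ x, ‖f x‖ ^ 4 := by
  simp only [Fintype.sum_prod_type, Finset.mul_sum (s := (Finset.univ : Finset G))]
  refine Finset.sum_le_sum fun x _ => ?_
  rw [← Finset.mul_sum]
  exact sum_norm_sq_diff_le fun t => f (x, t)

theorem sum_norm_sq_horizDiff_le (f : G × G → ℂ) :
    ∑ κ : G × G × G, ‖f (κ.1 + κ.2.2, κ.2.1) * (starRingEnd ℂ) (f (κ.1, κ.2.1))‖ ^ 2 ≤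
      (Fintype.card G : ℝ) * ∑ x, ‖f x‖ ^ 4 := by
  have := sum_norm_sq_vertDiff_le fun x => f x.swap
  simp only [Fintype.sum_prod_type, vertDiff, Prod.swap_prod_mk] at this ⊢
  rw [Finset.sum_comm, Finset.sum_comm (f := fun x y => ‖f (x, y)‖ ^ 4)]
  exact this

variable [DecidableEq G]

theorem sum_norm_sq_average_eq (P Q : S → G) (f1 f2 : G × G → ℂ) :
    ((∑ x : G × G, ‖∑ y, f1 (x.1 + P y, x.2) * f2 (x.1, x.2 + Q y)‖ ^ 2 : ℝ) : ℂ) =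
      ∑ κ : G × G × G, f1 (κ.1 + κ.2.2, κ.2.1) * (starRingEnd ℂ) (f1 (κ.1, κ.2.1)) *
        corrOp (fun z : S × S => -P z.2) (fun z => Q z.2) (pairDiff P) (pairDiff Q)
          (fun κ => vertDiff f2 κ.1 κ.2.1 κ.2.2) κ := by
  rw [sum_mul_corrOp (H := fun κ : G × G × G =>
    f1 (κ.1 + κ.2.2, κ.2.1) * (starRingEnd ℂ) (f1 (κ.1, κ.2.1)))]
  push_cast
  simp_rw [← Complex.mul_conj', map_sum, Finset.sum_mul_sum, ← Fintype.sum_prod_type']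
  refine (Fintype.sum_prod_type _).trans (Finset.sum_comm.trans
    (.trans ?_ (Fintype.sum_prod_type _).symm))
  refine Finset.sum_congr rfl fun z _ => ?_
  refine Fintype.sum_equiv ((Equiv.addRight (P z.2)).prodCongr (Equiv.refl G)) _ _ fun x => ?_
  simp only [pairDiff, vertDiff, Equiv.prodCongr_apply, Prod.map, Equiv.coe_addRight,
    Equiv.refl_apply, map_mul]
  rw [show x.1 + P z.2 + (P z.1 - P z.2) = x.1 + P z.1 by abel,
    show x.1 + P z.2 + -P z.2 = x.1 by abel,
    show x.2 + Q z.2 + (Q z.1 - Q z.2) = x.2 + Q z.1 by abel]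
  ring

theorem sum_norm_sq_corrOp_sq_le {Z : Type*} [Fintype Z] (a b u v : Z → G)
    (F : G × G × G → ℂ) :
    (∑ κ, ‖corrOp a b u v F κ‖ ^ 2) ^ 2 ≤ (∑ κ, ‖F κ‖ ^ 2) *
      ∑ κ, ‖corrOp (-a) (-b) v u (corrOp a b u v F) κ‖ ^ 2 := by
  have h : ((∑ κ, ‖corrOp a b u v F κ‖ ^ 2 : ℝ) : ℂ) =
      ∑ κ, F κ * (starRingEnd ℂ) (corrOp (-a) (-b) v u (corrOp a b u v F) κ) := by
    rw [← sum_conj_mul_corrOp]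
    push_cast
    simp_rw [← Complex.conj_mul']
  have h2 := norm_sum_mul_sq_le F
    fun κ => (starRingEnd ℂ) (corrOp (-a) (-b) v u (corrOp a b u v F) κ)
  rw [← h, Complex.norm_real, Real.norm_eq_abs, sq_abs] at h2
  simpa using h2

theorem sum_norm_sq_corrOp_corrOp_sq_le (P Q : S → G) (F : G × G × G → ℂ) :
    (∑ κ, ‖corrOp (-fun z : S × S => -P z.2) (-fun z => Q z.2) (pairDiff Q) (pairDiff P)
        (corrOp (fun z : S × S => -P z.2) (fun z => Q z.2) (pairDiff P) (pairDiff Q) F) κ‖ ^ 2)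
          ^ 2 ≤
      (Nat.card {y : Fin 16 → S // IsRothTuple P Q y} : ℝ) *
        ∑ κ : G × G × G × G, ‖∑ x, ∑ t, F (x, t, κ.2.2.1) *
          (starRingEnd ℂ) (F (x + κ.1, t + κ.2.1, κ.2.2.2))‖ ^ 2 := by
  have h : ((∑ κ, ‖corrOp (-fun z : S × S => -P z.2) (-fun z => Q z.2) (pairDiff Q) (pairDiff P)
      (corrOp (fun z : S × S => -P z.2) (fun z => Q z.2) (pairDiff P) (pairDiff Q) F) κ‖ ^ 2 :
        ℝ) : ℂ) =
      ∑ ω : Chain P Q, (fun κ : G × G × G × G => ∑ x, ∑ t, F (x, t, κ.2.2.1) *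
          (starRingEnd ℂ) (F (x + κ.1, t + κ.2.1, κ.2.2.2))) (chainShift P Q ω) := by
    rw [corrOp_corrOp, sum_norm_sq_corrOp]
    simp only [chainShift, Pi.neg_apply, neg_neg]
  have h2 := norm_sum_comp_sq_le (chainShift P Q) (fun κ : G × G × G × G => ∑ x, ∑ t,
    F (x, t, κ.2.2.1) * (starRingEnd ℂ) (F (x + κ.1, t + κ.2.1, κ.2.2.2)))
  rw [← h, Complex.norm_real, Real.norm_eq_abs, sq_abs] at h2
  refine h2.trans (mul_le_mul_of_nonneg_right ?_ (Finset.sum_nonneg fun _ _ => sq_nonneg _))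
  exact_mod_cast card_chain_pairs_le P Q

theorem norm_corner_sum_pow_le (P Q : S → G) (f0 f1 f2 : G × G → ℂ) (hf2 : ∀ x, ‖f2 x‖ ≤ 1) :
    ‖∑ x : G × G, f0 x * ∑ y, f1 (x.1 + P y, x.2) * f2 (x.1, x.2 + Q y)‖ ^ 16 ≤
      (∑ x, ‖f0 x‖ ^ 2) ^ 8 * ((Fintype.card G : ℝ) * ∑ x, ‖f1 x‖ ^ 4) ^ 4 *
        ((Fintype.card G : ℝ) * ∑ x, ‖f2 x‖ ^ 4) ^ 2 *
        ((Nat.card {y : Fin 16 → S // IsRothTuple P Q y} : ℝ) * ((Fintype.card G : ℝ) ^ 4 *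
          ∑ x, ∑ δ, ‖autocorr (fun t => f2 (x, t)) δ‖ ^ 2)) := by
  set F : G × G × G → ℂ := fun κ => vertDiff f2 κ.1 κ.2.1 κ.2.2
  set B : ℝ := ∑ x : G × G, ‖∑ y, f1 (x.1 + P y, x.2) * f2 (x.1, x.2 + Q y)‖ ^ 2
  set N := corrOp (fun z : S × S => -P z.2) (fun z => Q z.2) (pairDiff P) (pairDiff Q) F
  set T : ℝ := ∑ κ, ‖N κ‖ ^ 2
  set W : ℝ := ∑ κ, ‖corrOp (-fun z : S × S => -P z.2) (-fun z => Q z.2) (pairDiff Q)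
    (pairDiff P) N κ‖ ^ 2
  have hB0 : 0 ≤ B := Finset.sum_nonneg fun _ _ => sq_nonneg _
  have hT0 : 0 ≤ T := Finset.sum_nonneg fun _ _ => sq_nonneg _
  have hW0 : 0 ≤ W := Finset.sum_nonneg fun _ _ => sq_nonneg _
  have h0 := norm_sum_mul_sq_le f0
    fun x => ∑ y, f1 (x.1 + P y, x.2) * f2 (x.1, x.2 + Q y)
  have h1 : B ^ 2 ≤ ((Fintype.card G : ℝ) * ∑ x, ‖f1 x‖ ^ 4) * T := by
    have h := norm_sum_mul_sq_le (fun κ : G × G × G =>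
      f1 (κ.1 + κ.2.2, κ.2.1) * (starRingEnd ℂ) (f1 (κ.1, κ.2.1))) N
    rw [← sum_norm_sq_average_eq, Complex.norm_real, Real.norm_eq_abs, sq_abs] at h
    exact h.trans (mul_le_mul_of_nonneg_right (sum_norm_sq_horizDiff_le f1) hT0)
  have h2 : T ^ 2 ≤ ((Fintype.card G : ℝ) * ∑ x, ‖f2 x‖ ^ 4) * W :=
    (sum_norm_sq_corrOp_sq_le _ _ _ _ F).trans
      (mul_le_mul_of_nonneg_right (sum_norm_sq_vertDiff_le f2) hW0)
  have h3 := (sum_norm_sq_corrOp_corrOp_sq_le P Q F).trans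
    (mul_le_mul_of_nonneg_left (sum_norm_sq_vertDiff_correlation_le hf2) (Nat.cast_nonneg _))
  set A0 : ℝ := ∑ x, ‖f0 x‖ ^ 2
  set A1 : ℝ := (Fintype.card G : ℝ) * ∑ x, ‖f1 x‖ ^ 4
  set A2 : ℝ := (Fintype.card G : ℝ) * ∑ x, ‖f2 x‖ ^ 4
  have hA0 : 0 ≤ A0 := by positivity
  have hA1 : 0 ≤ A1 := by positivity
  have hA2 : 0 ≤ A2 := by positivity
  set Λ := ‖∑ x : G × G, f0 x * ∑ y, f1 (x.1 + P y, x.2) * f2 (x.1, x.2 + Q y)‖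
  calc Λ ^ 16 = (Λ ^ 2) ^ 8 := by ring
    _ ≤ (A0 * B) ^ 8 := pow_le_pow_left₀ (sq_nonneg _) h0 8
    _ = A0 ^ 8 * (B ^ 2) ^ 4 := by ring
    _ ≤ A0 ^ 8 * (A1 * T) ^ 4 :=
        mul_le_mul_of_nonneg_left (pow_le_pow_left₀ (sq_nonneg _) h1 4) (pow_nonneg hA0 _)
    _ = A0 ^ 8 * A1 ^ 4 * (T ^ 2) ^ 2 := by ring
    _ ≤ A0 ^ 8 * A1 ^ 4 * (A2 * W) ^ 2 :=
        mul_le_mul_of_nonneg_left (pow_le_pow_left₀ (sq_nonneg _) h2 2)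
          (mul_nonneg (pow_nonneg hA0 _) (pow_nonneg hA1 _))
    _ = A0 ^ 8 * A1 ^ 4 * A2 ^ 2 * W ^ 2 := by ring
    _ ≤ _ := mul_le_mul_of_nonneg_left h3
          (mul_nonneg (mul_nonneg (pow_nonneg hA0 _) (pow_nonneg hA1 _)) (pow_nonneg hA2 _))

end RothTuples

end GroupSums

theorem sum_norm_sq_autocorr_eq_re (f : ZMod p × ZMod p → ℂ) :
    ∑ x, ∑ δ, ‖autocorr (fun t => f (x, t)) δ‖ ^ 2 =
      (∑ x : ZMod p × ZMod p, ∑ h : ZMod p, ∑ k : ZMod p,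
        f x * (starRingEnd ℂ) (f (x + (0, h))) * (starRingEnd ℂ) (f (x + (0, k))) *
          f (x + (0, h + k))).re := by
  rw [← Complex.ofReal_re (∑ x, _), Complex.ofReal_sum, Fintype.sum_prod_type]
  congr 1
  refine Finset.sum_congr rfl fun x _ => ?_
  rw [sum_norm_sq_autocorr]
  simp

theorem Lnorm_pow (f : ZMod p × ZMod p → ℂ) {n : ℕ} (hn : n ≠ 0) :
    Lnorm p n f ^ n = (p : ℝ)⁻¹ ^ 2 * ∑ x, ‖f x‖ ^ n := by
  rw [Lnorm, Real.rpow_inv_natCast_pow (by positivity) hn]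
  simp

theorem Lnorm_nonneg (r : ℝ) (f : ZMod p × ZMod p → ℂ) : 0 ≤ Lnorm p r f := by
  unfold Lnorm
  positivity

theorem U2vert_nonneg (f : ZMod p × ZMod p → ℂ) : 0 ≤ U2vert p f := by
  rw [U2vert, ← sum_norm_sq_autocorr_eq_re]
  positivity

theorem U2vert_pow_four (f : ZMod p × ZMod p → ℂ) :
    U2vert p f ^ 4 =
      (p : ℝ)⁻¹ ^ 4 * ∑ x, ∑ δ, ‖autocorr (fun t => f (x, t)) δ‖ ^ 2 := by
  rw [U2vert, ← sum_norm_sq_autocorr_eq_re]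
  exact Real.rpow_inv_natCast_pow (n := 4) (by positivity) (by norm_num)

/-- The elements of `F_p` that are poles of neither `P` nor `Q`. -/
abbrev NonPole (P Q : RatFunc ℚ) : Type := {y : ZMod p // ¬ IsPole p P y ∧ ¬ IsPole p Q y}

theorem cornerAvg_eq (P Q : RatFunc ℚ) (f0 f1 f2 : ZMod p × ZMod p → ℂ) :
    cornerAvg p P Q f0 f1 f2 = (p : ℂ)⁻¹ ^ 3 * ∑ x : ZMod p × ZMod p, f0 x *
      ∑ y : NonPole p P Q, f1 (x.1 + evalRed p P y, x.2) * f2 (x.1, x.2 + evalRed p Q y) := by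
  rw [cornerAvg, Fintype.sum_prod_type]
  refine congrArg _ (Finset.sum_congr rfl fun x1 _ => Finset.sum_congr rfl fun x2 _ => ?_)
  rw [Finset.mul_sum, sum_subtype_eq_sum_ite (fun y => ¬ IsPole p P y ∧ ¬ IsPole p Q y)
    (fun y => f0 (x1, x2) * (f1 (x1 + evalRed p P y, x2) * f2 (x1, x2 + evalRed p Q y)))]
  simp only [mul_assoc]

theorem card_rothTuple_le (P Q : RatFunc ℚ) :
    Nat.card {y : Fin 16 → NonPole p P Q //
      IsRothTuple (fun y : NonPole p P Q => evalRed p P y) (fun y => evalRed p Q y) y} ≤ rothCard p P Q := by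
  refine Nat.card_le_card_of_injective
    (fun y => ⟨fun i => (y.1 i : ZMod p), fun i => (y.1 i).2.1, fun i => (y.1 i).2.2, y.2⟩) ?_
  intro y y' h
  refine Subtype.ext (funext fun i => Subtype.ext ?_)
  exact congrFun (congrArg Subtype.val h) i

/-- **Theorem 3.2.** Gowers norm control of the corner counting operator via the
point count of the Roth variety. -/
theorem gowers_control (P Q : RatFunc ℚ) :
    ∃ C : ℝ, 0 < C ∧ ∀ (p : ℕ) [Fact p.Prime],
      Admissible p P → Admissible p Q →
      ∀ f0 f1 f2 : ZMod p × ZMod p → ℂ,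
        OneBounded f0 → OneBounded f1 → OneBounded f2 →
        ‖cornerAvg p P Q f0 f1 f2‖ ≤
          Lnorm p 2 f0 * Lnorm p 4 f1 * Lnorm p 4 f2 ^ ((2:ℝ)⁻¹) *
            U2vert p f2 ^ ((4:ℝ)⁻¹) *
            ((rothCard p P Q : ℝ) / (p : ℝ) ^ 6) ^ ((16:ℝ)⁻¹) := by
  refine ⟨1, one_pos, fun p _ _ _ f0 f1 f2 _ _ hf2 => ?_⟩
  have hp : (p : ℝ) ≠ 0 := Nat.cast_ne_zero.2 (NeZero.ne p)
  have hL0 := Lnorm_nonneg p 2 f0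
  have hL1 := Lnorm_nonneg p 4 f1
  have hL2 := Lnorm_nonneg p 4 f2
  have hU := U2vert_nonneg p f2
  refine le_of_pow_le_pow_left₀ (n := 16) (by norm_num) (by positivity) ?_
  have hr : (Lnorm p 4 f2 ^ ((2:ℝ)⁻¹)) ^ 2 = Lnorm p 4 f2 :=
    Real.rpow_inv_natCast_pow (n := 2) hL2 (by norm_num)
  have hu : (U2vert p f2 ^ ((4:ℝ)⁻¹)) ^ 4 = U2vert p f2 :=
    Real.rpow_inv_natCast_pow (n := 4) hU (by norm_num)
  have hy : (((rothCard p P Q : ℝ) / (p : ℝ) ^ 6) ^ ((16:ℝ)⁻¹)) ^ 16 =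
      (rothCard p P Q : ℝ) / (p : ℝ) ^ 6 :=
    Real.rpow_inv_natCast_pow (n := 16) (by positivity) (by norm_num)
  have h0 : Lnorm p 2 f0 ^ 2 = _ := Lnorm_pow p f0 two_ne_zero
  have h1 : Lnorm p 4 f1 ^ 4 = _ := Lnorm_pow p f1 four_ne_zero
  have h2 : Lnorm p 4 f2 ^ 4 = _ := Lnorm_pow p f2 four_ne_zero
  have h3 := U2vert_pow_four p f2
  have key := norm_corner_sum_pow_le (fun y : NonPole p P Q => evalRed p P y)
    (fun y => evalRed p Q y) f0 f1 f2 hf2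
  have hcard : (Nat.card {y : Fin 16 → NonPole p P Q //
      IsRothTuple (fun y : NonPole p P Q => evalRed p P y) (fun y => evalRed p Q y) y} : ℝ) ≤
        rothCard p P Q := by
    exact_mod_cast card_rothTuple_le p P Q
  rw [ZMod.card] at key
  have key2 := key.trans (mul_le_mul_of_nonneg_left
    (mul_le_mul_of_nonneg_right hcard (by positivity)) (by positivity))
  calc ‖cornerAvg p P Q f0 f1 f2‖ ^ 16
      ≤ ((p : ℝ)⁻¹ ^ 3) ^ 16 * ((∑ x, ‖f0 x‖ ^ 2) ^ 8 * (p * ∑ x, ‖f1 x‖ ^ 4) ^ 4 *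
          (p * ∑ x, ‖f2 x‖ ^ 4) ^ 2 * ((rothCard p P Q : ℝ) * ((p : ℝ) ^ 4 *
            ∑ x, ∑ δ, ‖autocorr (fun t => f2 (x, t)) δ‖ ^ 2))) := by
        rw [cornerAvg_eq, norm_mul, mul_pow, norm_pow, norm_inv, Complex.norm_natCast]
        exact mul_le_mul_of_nonneg_left key2 (by positivity)
    _ = (Lnorm p 2 f0 ^ 2) ^ 8 * (Lnorm p 4 f1 ^ 4) ^ 4 * (Lnorm p 4 f2 ^ 4) ^ 2 *
          U2vert p f2 ^ 4 * ((rothCard p P Q : ℝ) / (p : ℝ) ^ 6) := by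
        rw [h0, h1, h2, h3]
        field_simp
    _ = (Lnorm p 2 f0 ^ 2) ^ 8 * (Lnorm p 4 f1 ^ 4) ^ 4 *
          (((Lnorm p 4 f2 ^ ((2:ℝ)⁻¹)) ^ 2) ^ 4) ^ 2 * ((U2vert p f2 ^ ((4:ℝ)⁻¹)) ^ 4) ^ 4 *
          (((rothCard p P Q : ℝ) / (p : ℝ) ^ 6) ^ ((16:ℝ)⁻¹)) ^ 16 := by
        rw [hr, hu, hy]
    _ = _ := by ring
end RatCorners
end
end

section
/- For every prime p and all functions f1, f2 : F_p^2 → ℂ, defining F1(n1,h) = Σ_{n2∈F_p} Δ_{−h} f̂1(n1,n2) and F2(m2,h) = Σ_{m1∈F_p} Δ_{h} f̂2(m1,m2) for h ∈ F_p^2, one has ‖F1(n1,h)‖_{ℓ^2_{n1,h}} ≤ ‖f1‖_4^2 and ‖F2(m2,h)‖_{ℓ^2_{m2,h}} ≤ ‖f2‖_4^2. -/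
open scoped BigOperators ComplexOrder
open Polynomial

noncomputable section

namespace RatCorners

variable (p : ℕ) [NeZero p]

lemma ep_eq_stdAddChar (x : ZMod p) : ep p x = ZMod.stdAddChar x := by
  rw [ZMod.stdAddChar_apply, ZMod.toCircle_apply, ep]

lemma sum_dft_mul_conj_dft (u v : ZMod p → ℂ) (h : ZMod p) :
    ∑ k, ZMod.dft u k * (starRingEnd ℂ) (ZMod.dft v (k - h)) =
      p * ZMod.dft (fun x => u x * (starRingEnd ℂ) (v x)) h := by
  have orth (x y : ZMod p) :
      ∑ k : ZMod p, (ZMod.stdAddChar (k * (y - x)) : ℂ) = if y = x then (p : ℂ) else 0 := by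
    rw [AddChar.sum_mulShift _ (ZMod.isPrimitive_stdAddChar p)]
    simp [sub_eq_zero]
  calc ∑ k, ZMod.dft u k * (starRingEnd ℂ) (ZMod.dft v (k - h))
      = ∑ k, ∑ x, ∑ y, u x * (starRingEnd ℂ) (v y) * ZMod.stdAddChar (-(y * h)) *
          ZMod.stdAddChar (k * (y - x)) := by
        refine Finset.sum_congr rfl fun k _ => ?_
        rw [ZMod.dft_apply, ZMod.dft_apply, map_sum, Finset.sum_mul_sum]
        refine Finset.sum_congr rfl fun x _ => Finset.sum_congr rfl fun y _ => ?_
        have : (ZMod.stdAddChar (-(y * h)) : ℂ) * ZMod.stdAddChar (k * (y - x)) =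
            ZMod.stdAddChar (-(x * k)) * ZMod.stdAddChar (y * (k - h)) := by
          rw [← AddChar.map_add_eq_mul, ← AddChar.map_add_eq_mul]
          congr 1
          ring
        rw [smul_eq_mul, smul_eq_mul, map_mul, AddChar.map_neg_eq_conj (_ : AddChar (ZMod p) ℂ)
          (y * (k - h)), Complex.conj_conj, mul_assoc _ (ZMod.stdAddChar (-(y * h))), this]
        ring
    _ = ∑ x, ∑ y, u x * (starRingEnd ℂ) (v y) * ZMod.stdAddChar (-(y * h)) *
          ∑ k : ZMod p, ZMod.stdAddChar (k * (y - x)) := by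
        rw [Finset.sum_comm]
        refine Finset.sum_congr rfl fun x _ => ?_
        rw [Finset.sum_comm]
        simp only [Finset.mul_sum]
    _ = p * ZMod.dft (fun x => u x * (starRingEnd ℂ) (v x)) h := by
        simp only [orth, mul_ite, mul_zero, Finset.sum_ite_eq',
          Finset.mem_univ, if_true, ZMod.dft_apply, smul_eq_mul, Finset.mul_sum]
        exact Finset.sum_congr rfl fun x _ => by ring

lemma sum_norm_sq_dft (u : ZMod p → ℂ) :
    ∑ k, ‖ZMod.dft u k‖ ^ 2 = p * ∑ x, ‖u x‖ ^ 2 := by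
  have := sum_dft_mul_conj_dft p u u 0
  simp only [sub_zero, Complex.mul_conj', ZMod.dft_apply_zero] at this
  exact_mod_cast this

lemma dft_eq_iterated (f : ZMod p × ZMod p → ℂ) (n k : ZMod p) :
    dft p f (n, k) =
      (p : ℂ)⁻¹ ^ 2 * ZMod.dft (fun y => ZMod.dft (fun x => f (x, y)) n) k := by
  simp only [dft, ep_eq_stdAddChar, ZMod.dft_apply, Fintype.sum_prod_type_right, smul_eq_mul,
    Finset.mul_sum, neg_add, AddChar.map_add_eq_mul]
  exact Finset.sum_congr rfl fun y _ => Finset.sum_congr rfl fun x _ => by ring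

lemma F1_eq (f : ZMod p × ZMod p → ℂ) (n a b : ZMod p) :
    F1 p f n (a, b) = (p : ℂ)⁻¹ ^ 3 * ZMod.dft (fun y => ZMod.dft (fun x => f (x, y)) n *
      (starRingEnd ℂ) (ZMod.dft (fun x => f (x, y)) (n - a))) b := by
  have hp : (p : ℂ) ≠ 0 := NeZero.ne _
  have key := sum_dft_mul_conj_dft p (fun y => ZMod.dft (fun x => f (x, y)) n)
    (fun y => ZMod.dft (fun x => f (x, y)) (n - a)) b
  calc F1 p f n (a, b) = (p : ℂ)⁻¹ ^ 4 * ∑ k, ZMod.dft (fun y => ZMod.dft (fun x => f (x, y)) n) k *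
        (starRingEnd ℂ) (ZMod.dft (fun y => ZMod.dft (fun x => f (x, y)) (n - a)) (k - b)) := by
        simp only [F1, Prod.neg_mk, Prod.mk_add_mk, ← sub_eq_add_neg, dft_eq_iterated,
          Finset.mul_sum, map_mul, map_pow, map_inv₀, Complex.conj_natCast]
        exact Finset.sum_congr rfl fun y _ => by ring
    _ = _ := by
        rw [key]
        field_simp

lemma sum_norm_sq_F1 (f : ZMod p × ZMod p → ℂ) :
    ∑ n, ∑ h, ‖F1 p f n h‖ ^ 2 = (p : ℝ)⁻¹ ^ 3 * ∑ y, (∑ x, ‖f (x, y)‖ ^ 2) ^ 2 := by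
  have hp : (p : ℝ) ≠ 0 := NeZero.ne _
  set G : ZMod p → ZMod p → ℂ := fun n y => ZMod.dft (fun x => f (x, y)) n with hG
  have inner (n a : ZMod p) :
      ∑ b, ‖F1 p f n (a, b)‖ ^ 2 = (p : ℝ)⁻¹ ^ 5 * ∑ y, ‖G n y‖ ^ 2 * ‖G (n - a) y‖ ^ 2 := by
    simp only [F1_eq, norm_mul, mul_pow, norm_pow, norm_inv, Complex.norm_natCast]
    rw [← Finset.mul_sum, sum_norm_sq_dft]
    simp only [norm_mul, mul_pow, RCLike.norm_conj, hG]
    field_simp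
  calc ∑ n, ∑ h, ‖F1 p f n h‖ ^ 2
      = ∑ n, ∑ m, (p : ℝ)⁻¹ ^ 5 * ∑ y, ‖G n y‖ ^ 2 * ‖G m y‖ ^ 2 := by
        refine Finset.sum_congr rfl fun n _ => ?_
        rw [Fintype.sum_prod_type]
        simp only [inner]
        exact Equiv.sum_comp (Equiv.subLeft n)
          fun m => (p : ℝ)⁻¹ ^ 5 * ∑ y, ‖G n y‖ ^ 2 * ‖G m y‖ ^ 2
    _ = (p : ℝ)⁻¹ ^ 5 * ∑ y, (∑ n, ‖G n y‖ ^ 2) ^ 2 := by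
        simp only [← Finset.mul_sum]
        congr 1
        refine ((Finset.sum_congr rfl fun n _ => Finset.sum_comm).trans Finset.sum_comm).trans ?_
        exact Finset.sum_congr rfl fun y _ => by rw [sq, Finset.sum_mul_sum]
    _ = _ := by
        simp only [hG, sum_norm_sq_dft, mul_pow, ← Finset.mul_sum]
        field_simp

lemma sum_norm_sq_F1_le (f : ZMod p × ZMod p → ℂ) :
    ∑ n, ∑ h, ‖F1 p f n h‖ ^ 2 ≤ (p : ℝ)⁻¹ ^ 2 * ∑ x, ‖f x‖ ^ 4 := by
  have hp : (p : ℝ) ≠ 0 := NeZero.ne _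
  have cs (y : ZMod p) : (∑ x, ‖f (x, y)‖ ^ 2) ^ 2 ≤ p * ∑ x, ‖f (x, y)‖ ^ 4 := by
    have := sq_sum_le_card_mul_sum_sq (s := Finset.univ) (f := fun x => ‖f (x, y)‖ ^ 2)
    simpa only [← pow_mul, Finset.card_univ, ZMod.card, Nat.reduceMul] using this
  calc ∑ n, ∑ h, ‖F1 p f n h‖ ^ 2
      ≤ (p : ℝ)⁻¹ ^ 3 * ∑ y, p * ∑ x, ‖f (x, y)‖ ^ 4 := by
        rw [sum_norm_sq_F1]
        gcongr with y
        exact cs y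
    _ = _ := by
        rw [Fintype.sum_prod_type_right, ← Finset.mul_sum]
        field_simp

lemma F1_l2_le (f : ZMod p × ZMod p → ℂ) :
    (∑ n, ∑ h, ‖F1 p f n h‖ ^ 2) ^ ((2 : ℝ)⁻¹) ≤ Lnorm p 4 f ^ 2 := by
  have hL : Lnorm p 4 f ^ 2 = ((p : ℝ)⁻¹ ^ 2 * ∑ x, ‖f x‖ ^ 4) ^ ((2 : ℝ)⁻¹) := by
    rw [Lnorm, ← Real.rpow_mul_natCast (by positivity)]
    norm_num
  rw [hL]
  exact Real.rpow_le_rpow (by positivity) (sum_norm_sq_F1_le p f) (by norm_num)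

lemma dft_comp_swap (f : ZMod p × ZMod p → ℂ) (ξ : ZMod p × ZMod p) :
    dft p (f ∘ Prod.swap) ξ = dft p f ξ.swap := by
  rw [dft, dft, ← Equiv.sum_comp (Equiv.prodComm (ZMod p) (ZMod p))]
  simp [add_comm]

lemma F2_eq_F1_comp_swap (f : ZMod p × ZMod p → ℂ) (m : ZMod p) (h : ZMod p × ZMod p) :
    F2 p f m h = F1 p (f ∘ Prod.swap) m (-h.swap) := by
  simp [F1, F2, dft_comp_swap]

lemma Lnorm_comp_swap (r : ℝ) (f : ZMod p × ZMod p → ℂ) :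
    Lnorm p r (f ∘ Prod.swap) = Lnorm p r f := by
  rw [Lnorm, Lnorm, ← Equiv.sum_comp (Equiv.prodComm (ZMod p) (ZMod p))]
  simp

lemma F2_l2_le (f : ZMod p × ZMod p → ℂ) :
    (∑ m, ∑ h, ‖F2 p f m h‖ ^ 2) ^ ((2 : ℝ)⁻¹) ≤ Lnorm p 4 f ^ 2 := by
  have hF (m : ZMod p) : ∑ h, ‖F2 p f m h‖ ^ 2 = ∑ h, ‖F1 p (f ∘ Prod.swap) m h‖ ^ 2 := by
    simp only [F2_eq_F1_comp_swap]
    exact Equiv.sum_comp ((Equiv.prodComm (ZMod p) (ZMod p)).trans (Equiv.neg _))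
      fun h => ‖F1 p (f ∘ Prod.swap) m h‖ ^ 2
  simp only [hF]
  exact (F1_l2_le p _).trans_eq (by rw [Lnorm_comp_swap])

/-- **Proposition 3.4.** `ℓ²` bounds for the Fourier quantities `F₁` and `F₂`. -/
theorem F_l2_bounds (p : ℕ) [Fact p.Prime] (f1 f2 : ZMod p × ZMod p → ℂ) :
    (∑ n1 : ZMod p, ∑ h : ZMod p × ZMod p, ‖F1 p f1 n1 h‖ ^ 2) ^ ((2:ℝ)⁻¹) ≤
        Lnorm p 4 f1 ^ 2 ∧
      (∑ m2 : ZMod p, ∑ h : ZMod p × ZMod p, ‖F2 p f2 m2 h‖ ^ 2) ^ ((2:ℝ)⁻¹) ≤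
        Lnorm p 4 f2 ^ 2 := by
  exact ⟨F1_l2_le p f1, F2_l2_le p f2⟩
end RatCorners
end
end
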